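/- Let (a_n) be lacunary with constant c > 1, r ≥ 1 an integer, ε > 0. Call a vector v = (y_1,...,y_r,z_1,...,z_r) ∈ ℤ^{2r} degenerate if for every 1 ≤ i ≤ r, the sum of y_j over all j with z_j = z_i vanishes. Then for any M ≥ 1 and K ≥ 1, the number of non-degenerate vectors v with |y_i| ≤ M for all i, 1 ≤ z_i ≤ M for all i (not necessarily distinct), |y_1 a_{z_1} + ... + y_r a_{z_r}| ≤ K, and y_1 + ... + y_r = 0, is O(K^r · M^{r-1+ε}). -/

import Mathlib

open Finset

inductive Cat | fol | zero | near | far | lowbot | botB | topB | botC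
deriving DecidableEq

instance : Fintype Cat where
  elems := {.fol, .zero, .near, .far, .lowbot, .botB, .topB, .botC}
  complete := by intro x; cases x <;> simp

def Cat.sp (c : Cat) : Prop := c = .lowbot ∨ c = .botB ∨ c = .topB ∨ c = .botC

abbrev Vec (r : ℕ) := (Fin r → ℤ) × (Fin r → ℕ)

def gs {r : ℕ} (p : Vec r) (i : Fin r) : ℤ :=
  ∑ j ∈ Finset.univ.filter (fun j => p.2 j = p.2 i), p.1 j

structure Base {r : ℕ} (a : ℕ → ℝ) (M K : ℝ) (p : Vec r) : Prop where
  hy : ∀ i, |(p.1 i : ℝ)| ≤ M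
  hz : ∀ i, 1 ≤ p.2 i ∧ (p.2 i : ℝ) ≤ M
  hs : |∑ i, (p.1 i : ℝ) * a (p.2 i)| ≤ K
  h0 : ∑ i, p.1 i = 0

structure PT {r : ℕ} (L : ℕ) (κ : Fin r → Cat) (pr : Fin r → Fin r)
    (E : Fin r → Fin r → Prop) (p : Vec r) : Prop where
  eqv : ∀ i j, E i j ↔ p.2 i = p.2 j
  fol : ∀ i, κ i = .fol → ∃ j, κ j ≠ .fol ∧ p.2 i = p.2 j
  uniq : ∀ i j, κ i ≠ .fol → κ j ≠ .fol → p.2 i = p.2 j → i = j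
  zero : ∀ i, κ i = .zero → gs p i = 0
  act : ∀ i, κ i ≠ .fol → κ i ≠ .zero → gs p i ≠ 0
  near : ∀ i, κ i = .near ∨ κ i = .topB → p.2 (pr i) < p.2 i ∧ p.2 i ≤ p.2 (pr i) + L
  farL : ∀ i, κ i = .far → L < p.2 i
  far : ∀ i, κ i = .far → ∀ j, gs p j ≠ 0 → p.2 j < p.2 i → p.2 j + L < p.2 i
  bot : ∀ b, κ b = .lowbot ∨ κ b = .botB ∨ κ b = .botC → ∀ j, gs p j ≠ 0 → p.2 b ≤ p.2 j
  low : ∀ b, κ b = .lowbot → p.2 b ≤ L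
  nlow : ∀ b, κ b = .botB ∨ κ b = .botC → L < p.2 b
  top : ∀ b b', κ b = .botB → κ b' = .topB → p.2 b < p.2 b' ∧ p.2 b' ≤ p.2 b + L
  isoC : ∀ b, κ b = .botC → ∀ j, gs p j ≠ 0 → p.2 j = p.2 b ∨ p.2 b + L < p.2 j
  cases : (∃ b, κ b = .lowbot ∧ ∀ i, (κ i).sp → i = b) ∨
    (∃ b b', κ b = .botB ∧ κ b' = .topB ∧ ∀ i, (κ i).sp → i = b ∨ i = b') ∨
    (∃ b, κ b = .botC ∧ ∀ i, (κ i).sp → i = b)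

def cy {r : ℕ} (κ : Fin r → Cat) (p : Vec r) (i : Fin r) : ℤ :=
  if κ i = .fol ∨ κ i = .near then p.1 i else 0
def cz {r : ℕ} (κ : Fin r → Cat) (p : Vec r) (i : Fin r) : ℕ :=
  if κ i = .zero ∨ κ i = .far ∨ κ i = .botB then p.2 i else 0
def cd {r : ℕ} (κ : Fin r → Cat) (pr : Fin r → Fin r) (p : Vec r) (i : Fin r) : ℕ :=
  if κ i = .near ∨ κ i = .topB then p.2 i - p.2 (pr i) else if κ i = .lowbot then p.2 i else 0

theorem cat_key {r : ℕ} (b : Fin r) (ld gz tp nr : Fin r → Prop) (kb : Cat)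
    (hkb : kb = .lowbot ∨ kb = .botB ∨ kb = .botC) (hb1 : ld b) (hb2 : ¬ gz b) :
     ∃ κ : Fin r → Cat, (∀ i, κ i = .fol ↔ ¬ ld i) ∧ (∀ i, κ i = .zero ↔ ld i ∧ gz i) ∧
      (∀ i, κ i = .far ↔ ld i ∧ ¬ gz i ∧ i ≠ b ∧ ¬ tp i ∧ ¬ nr i) ∧
      (∀ i, κ i = .near ↔ ld i ∧ ¬ gz i ∧ i ≠ b ∧ ¬ tp i ∧ nr i) ∧
      (∀ i, κ i = .topB ↔ ld i ∧ ¬ gz i ∧ i ≠ b ∧ tp i) ∧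
      (∀ i, (κ i = .lowbot ∨ κ i = .botB ∨ κ i = .botC) → i = b) ∧ κ b = kb := by
  classical
  refine ⟨fun i => if ¬ ld i then .fol else if gz i then .zero else if i = b then kb
      else if tp i then .topB else if nr i then .near else .far, ?_, ?_, ?_, ?_, ?_, ?_, ?_⟩
  all_goals grind

theorem exists_PT {r : ℕ} (L : ℕ) (p : Vec r) (h : ¬ ∀ i, gs p i = 0) :
    ∃ κ pr E, PT L κ pr E p := by
  classical
  push Not at h
  obtain ⟨i0, hi0⟩ := h
  have gcongr' : ∀ i j, p.2 i = p.2 j → gs p i = gs p j := by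
    intro i j hij; unfold gs; rw [hij]
  -- leader
  have hlead : ∀ i, ∃ l, p.2 l = p.2 i ∧ ∀ j, p.2 j = p.2 l → l ≤ j := by
    intro i
    obtain ⟨l, hl, hm⟩ := Finset.exists_min_image (univ.filter (fun j => p.2 j = p.2 i)) id
      ⟨i, by simp⟩
    simp only [mem_filter, mem_univ, true_and, id] at hl hm
    exact ⟨l, hl, fun j hj => hm j (hj.trans hl)⟩
  let ld : Fin r → Prop := fun l => ∀ j, p.2 j = p.2 l → l ≤ j
  have ldu : ∀ i j, ld i → ld j → p.2 i = p.2 j → i = j := fun i j hi hj hij =>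
    le_antisymm (hi j hij.symm) (hj i hij)
  obtain ⟨b, hb, hbm⟩ : ∃ b, (ld b ∧ gs p b ≠ 0) ∧ ∀ j, gs p j ≠ 0 → p.2 b ≤ p.2 j := by
    obtain ⟨b, hb, hm⟩ := Finset.exists_min_image (univ.filter (fun j => gs p j ≠ 0)) p.2
      ⟨i0, by simpa using hi0⟩
    simp only [mem_filter, mem_univ, true_and] at hb hm
    obtain ⟨l, hl, hl2⟩ := hlead b
    exact ⟨l, ⟨hl2, by rwa [gcongr' _ _ hl]⟩, fun j hj => hl ▸ hm j hj⟩
  let nr : Fin r → Prop := fun i => ∃ j, gs p j ≠ 0 ∧ p.2 j < p.2 i ∧ p.2 i ≤ p.2 j + L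
  obtain ⟨pr, hpr⟩ : ∃ pr : Fin r → Fin r, ∀ i, nr i → p.2 (pr i) < p.2 i ∧ p.2 i ≤ p.2 (pr i) + L := by
    refine ⟨fun i => if h : nr i then h.choose else i, fun i hi => ?_⟩
    simp only [hi, dif_pos]
    exact hi.choose_spec.2
  have hlt : ∀ i, ld i → gs p i ≠ 0 → i ≠ b → p.2 b < p.2 i := fun i h1 h2 h3 =>
    lt_of_le_of_ne (hbm i h2) (fun h => h3 (ldu _ _ h1 hb.1 h.symm))
  have hex : ∃ (kb : Cat) (tp : Fin r → Prop),
      (kb = .lowbot ∧ p.2 b ≤ L ∧ ∀ i, ¬ tp i) ∨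
      (kb = .botB ∧ L < p.2 b ∧ ∃ b', b' ≠ b ∧ ld b' ∧ gs p b' ≠ 0 ∧ p.2 b' ≤ p.2 b + L ∧
        ∀ i, tp i ↔ i = b') ∨
      (kb = .botC ∧ L < p.2 b ∧ (∀ i, ¬ tp i) ∧
        ∀ j, gs p j ≠ 0 → p.2 j = p.2 b ∨ p.2 b + L < p.2 j) := by
    by_cases hA : p.2 b ≤ L
    · exact ⟨.lowbot, fun _ => False, Or.inl ⟨rfl, hA, by simp⟩⟩
    by_cases hB : ∃ b', b' ≠ b ∧ ld b' ∧ gs p b' ≠ 0 ∧ p.2 b' ≤ p.2 b + L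
    · obtain ⟨b', h1, h2, h3, h4⟩ := hB
      exact ⟨.botB, fun i => i = b', Or.inr (Or.inl ⟨rfl, by omega, b', h1, h2, h3, h4, by simp⟩)⟩
    · refine ⟨.botC, fun _ => False, Or.inr (Or.inr ⟨rfl, by omega, by simp, ?_⟩)⟩
      intro j hj
      obtain ⟨l, hl, hl2⟩ := hlead j
      by_contra hcon
      push Not at hcon
      refine hB ⟨l, ?_, hl2, ?_, ?_⟩
      · rintro rfl; exact hcon.1 hl.symm
      · rwa [gcongr' _ _ hl]
      · omega
  obtain ⟨kb, tp, hk⟩ := hex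
  obtain ⟨κ, k1, k2, k3, k4, k5, k6, k7⟩ := cat_key b ld (fun i => gs p i = 0) tp nr kb
    (by rcases hk with h | h | h <;> simp [h.1]) hb.1 hb.2
  have hnr : ∀ i, κ i = .near ∨ κ i = .topB → nr i := by
    rintro i (hi | hi)
    · exact ((k4 i).1 hi).2.2.2.2
    · obtain ⟨h1, h2, h3, h4⟩ := (k5 i).1 hi
      have := hlt i h1 h2 h3
      rcases hk with ⟨_, _, h⟩ | ⟨_, _, b', _, _, _, h5, h⟩ | ⟨_, _, h, _⟩
      · exact absurd h4 (h i)
      · exact ⟨b, hb.2, this, by rw [(h i).1 h4]; exact h5⟩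
      · exact absurd h4 (h i)
  have hfl : ∀ i, κ i = .far → p.2 b + L < p.2 i := by
    intro i hi
    obtain ⟨h1, h2, h3, h4, h5⟩ := (k3 i).1 hi
    have := hlt i h1 h2 h3
    by_contra hcon
    exact h5 ⟨b, hb.2, this, by omega⟩
  refine ⟨κ, pr, fun i j => p.2 i = p.2 j, ?_⟩
  constructor
  · simp
  · intro i hi
    obtain ⟨l, hl, hl2⟩ := hlead i
    exact ⟨l, by rw [ne_eq, k1]; simpa using hl2, hl.symm⟩
  · intro i j hi hj hij
    rw [ne_eq, k1, not_not] at hi hj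
    exact ldu i j hi hj hij
  · intro i hi; exact ((k2 i).1 hi).2
  · intro i hi hj hg
    rw [ne_eq, k1, not_not] at hi
    exact hj ((k2 i).2 ⟨hi, hg⟩)
  · intro i hi; exact hpr i (hnr i hi)
  · intro i hi; have := hfl i hi; omega
  · intro i hi j hj hji
    by_contra hcon
    exact ((k3 i).1 hi).2.2.2.2 ⟨j, hj, hji, by omega⟩
  · intro b2 hb2 j hj
    rw [k6 b2 hb2]; exact hbm j hj
  · intro b2 hb2
    have e := k6 b2 (Or.inl hb2)
    subst e
    rcases hk with h | h | h
    · exact h.2.1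
    · rw [hb2] at k7; rw [h.1] at k7; cases k7
    · rw [hb2] at k7; rw [h.1] at k7; cases k7
  · intro b2 hb2
    have e := k6 b2 (Or.inr hb2)
    subst e
    rcases hk with h | h | h
    · rw [h.1] at k7; rw [k7] at hb2; simp at hb2
    · exact h.2.1
    · exact h.2.1
  · intro b2 b' hb2 hb'
    have e := k6 b2 (Or.inr (Or.inl hb2))
    subst e
    obtain ⟨h1, h2, h3, h4⟩ := (k5 b').1 hb'
    refine ⟨hlt b' h1 h2 h3, ?_⟩
    rcases hk with ⟨_, _, h⟩ | ⟨_, _, b', _, _, _, h5, h⟩ | ⟨_, _, h, _⟩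
    · exact absurd h4 (h _)
    · rw [(h _).1 h4]; exact h5
    · exact absurd h4 (h _)
  · intro b2 hb2
    have e := k6 b2 (Or.inr (Or.inr hb2))
    subst e
    rcases hk with h | h | h
    · rw [hb2] at k7; rw [h.1] at k7; cases k7
    · rw [hb2] at k7; rw [h.1] at k7; cases k7
    · exact h.2.2.2
  · have hsp : ∀ i, (κ i).sp → i = b ∨ κ i = .topB := by
      rintro i (h | h | h | h)
      · exact Or.inl (k6 i (by simp [h]))
      · exact Or.inl (k6 i (by simp [h]))
      · exact Or.inr h
      · exact Or.inl (k6 i (by simp [h]))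
    rcases hk with ⟨e, _, h⟩ | ⟨e, _, b', e1, e2, e3, h5, h⟩ | ⟨e, _, h, _⟩
    · refine Or.inl ⟨b, k7.trans e, fun i hi => ?_⟩
      rcases hsp i hi with h1 | h1
      · exact h1
      · exact absurd ((k5 i).1 h1).2.2.2 (h i)
    · refine Or.inr (Or.inl ⟨b, b', k7.trans e, (k5 b').2 ⟨e2, e3, e1, (h _).2 rfl⟩, fun i hi => ?_⟩)
      rcases hsp i hi with h1 | h1
      · exact Or.inl h1
      · exact Or.inr ((h i).1 ((k5 i).1 h1).2.2.2)
    · refine Or.inr (Or.inr ⟨b, k7.trans e, fun i hi => ?_⟩)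
      rcases hsp i hi with h1 | h1
      · exact h1
      · exact absurd ((k5 i).1 h1).2.2.2 (h i)

structure Ana (r : ℕ) (a : ℕ → ℝ) (M K : ℝ) (L : ℕ) : Prop where
  pos : ∀ n, 1 ≤ n → 0 < a n
  far : ∀ m n, 1 ≤ m → m + L < n → 4 * r * M * a m ≤ a n
  big : ∀ n, L < n → 4 * K < a n
  gap : ∀ m n, L < m → m < n → 2 * K < a n - a m

theorem far_unique {r : ℕ} {a : ℕ → ℝ} {M K : ℝ} {L : ℕ} (hM : 1 ≤ M) (hA : Ana r a M K L)
    {p q : Vec r} (hp : Base a M K p) (hq : Base a M K q) (i : Fin r) (hi : p.2 i = q.2 i)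
    (hiL : L < p.2 i)
    (h : ∀ j, j ≠ i → (p.1 j = q.1 j ∧ p.2 j = q.2 j) ∨
      (p.2 j + L < p.2 i ∧ q.2 j + L < p.2 i)) : p.1 i = q.1 i := by
  classical
  have hr : 0 < r := by have := i.2; omega
  have hr' : (1 : ℝ) ≤ r := by exact_mod_cast hr
  set A := a (p.2 i) with hAdef
  have hApos : 0 < A := hA.pos _ (hp.hz i).1
  have hbig := hA.big _ hiL
  have hu : ∀ j, j ≠ i → |(p.1 j : ℝ) * a (p.2 j) - q.1 j * a (q.2 j)| ≤ A / (2 * r) := by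
    intro j hj
    rcases h j hj with ⟨h1, h2⟩ | ⟨h1, h2⟩
    · rw [h1, h2, sub_self, abs_zero]; positivity
    · have e1 := hA.far _ _ (hp.hz j).1 h1
      have e2 := hA.far _ _ (hq.hz j).1 h2
      have p1 := hA.pos _ (hp.hz j).1
      have p2 := hA.pos _ (hq.hz j).1
      have b1 : |(p.1 j : ℝ) * a (p.2 j)| ≤ M * a (p.2 j) := by
        rw [abs_mul, abs_of_pos p1]; exact mul_le_mul_of_nonneg_right (hp.hy j) p1.le
      have b2 : |(q.1 j : ℝ) * a (q.2 j)| ≤ M * a (q.2 j) := by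
        rw [abs_mul, abs_of_pos p2]; exact mul_le_mul_of_nonneg_right (hq.hy j) p2.le
      refine (abs_sub _ _).trans ?_
      rw [le_div_iff₀ (by positivity)]
      have : (|(p.1 j : ℝ) * a (p.2 j)| + |(q.1 j : ℝ) * a (q.2 j)|) * (2 * r) ≤
        (M * a (p.2 j) + M * a (q.2 j)) * (2 * r) := by gcongr
      nlinarith
  have hsum : (∑ j, (p.1 j : ℝ) * a (p.2 j)) - ∑ j, (q.1 j : ℝ) * a (q.2 j) =
      ((p.1 i : ℝ) - q.1 i) * A +
        ∑ j ∈ univ.erase i, ((p.1 j : ℝ) * a (p.2 j) - q.1 j * a (q.2 j)) := by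
    rw [← Finset.sum_sub_distrib, ← Finset.add_sum_erase _ _ (mem_univ i), ← hi]
    ring
  have hrest : |∑ j ∈ univ.erase i, ((p.1 j : ℝ) * a (p.2 j) - q.1 j * a (q.2 j))| ≤ A / 2 := by
    refine (Finset.abs_sum_le_sum_abs _ _).trans ?_
    refine (Finset.sum_le_sum (g := fun _ => A / (2 * r)) fun j hj => hu j (by simpa using hj)).trans ?_
    rw [Finset.sum_const, nsmul_eq_mul]
    have hcard : ((univ.erase i).card : ℝ) ≤ r := by
      have := Finset.card_le_univ (univ.erase i); simp only [Fintype.card_fin] at this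
      exact_mod_cast this
    calc ((univ.erase i).card : ℝ) * (A / (2 * r)) ≤ r * (A / (2 * r)) := by gcongr
      _ = A / 2 := by field_simp
  have hlt : |((p.1 i : ℝ) - q.1 i) * A| < A := by
    have h1 := abs_le.1 hp.hs
    have h2 := abs_le.1 hq.hs
    have h3 := abs_le.1 hrest
    rw [abs_lt]; constructor <;> linarith
  rw [abs_mul, abs_of_pos hApos] at hlt
  have h1 : |(p.1 i : ℝ) - q.1 i| < 1 := by
    by_contra hcon
    push Not at hcon
    nlinarith
  have h2 : |p.1 i - q.1 i| < 1 := by exact_mod_cast h1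
  have := Int.abs_lt_one_iff.1 h2
  omega

theorem z_dec {r : ℕ} {L : ℕ} {κ : Fin r → Cat} {pr : Fin r → Fin r}
    {E : Fin r → Fin r → Prop} {p q : Vec r} (hp : PT L κ pr E p) (hq : PT L κ pr E q)
    (hz : ∀ i, cz κ p i = cz κ q i) (hd : ∀ i, cd κ pr p i = cd κ pr q i) :
    ∀ n i, p.2 i = n → (∀ b, κ b = .botC → p.2 i ≠ p.2 b) → p.2 i = q.2 i := by
  intro n
  induction n using Nat.strong_induction_on with
  | _ n ih =>
    have main : ∀ j, κ j ≠ .fol → p.2 j = n → (∀ b, κ b = .botC → p.2 j ≠ p.2 b) →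
        p.2 j = q.2 j := by
      intro j hj hjn hjb
      have hzj := hz j
      have hdj := hd j
      have hnear : κ j = .near ∨ κ j = .topB → p.2 j = q.2 j := by
        intro hk
        have h1 := hp.near j hk
        have h2 := hq.near j hk
        have h3 : p.2 (pr j) = q.2 (pr j) := by
          refine ih _ (by omega) _ rfl ?_
          intro b hb he
          have := hp.isoC b hb j (hp.act j hj (by rcases hk with h | h <;> simp [h]))
          have := hjb b hb
          omega
        simp only [cd, hk, if_true] at hdj
        omega
      rcases hk : κ j
      · exact absurd hk hj
      · simpa [cz, hk] using hzj
      · exact hnear (by simp [hk])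
      · simpa [cz, hk] using hzj
      · simpa [cd, hk] using hdj
      · simpa [cz, hk] using hzj
      · exact hnear (by simp [hk])
      · exact absurd rfl (hjb j hk)
    intro i hin hib
    by_cases hi : κ i = .fol
    · obtain ⟨j, hj, hij⟩ := hp.fol i hi
      have e : q.2 i = q.2 j := (hq.eqv i j).1 ((hp.eqv i j).2 hij)
      rw [hij, e]
      rw [hij] at hin hib
      exact main j hj hin hib
    · exact main i hi hin hib

theorem sp_far {r : ℕ} {L : ℕ} {κ : Fin r → Cat} {pr : Fin r → Fin r}
    {E : Fin r → Fin r → Prop} {p : Vec r} (hp : PT L κ pr E p) {i j : Fin r}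
    (hi : κ i = .far) (hj : (κ j).sp) : p.2 j + L < p.2 i := by
  have hgi := hp.act i (by simp [hi]) (by simp [hi])
  have hbot : ∀ b, κ b = .lowbot ∨ κ b = .botB ∨ κ b = .botC → p.2 b + L < p.2 i := by
    intro b hb
    refine hp.far i hi b (hp.act b ?_ ?_) ?_
    · rcases hb with h | h | h <;> simp [h]
    · rcases hb with h | h | h <;> simp [h]
    · refine lt_of_le_of_ne (hp.bot b hb i hgi) fun h => ?_
      have := hp.uniq b i (by rcases hb with h | h | h <;> simp [h]) (by simp [hi]) h
      subst this
      simp [hi] at hb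
  rcases hj with h | h | h | h
  · exact hbot j (by simp [h])
  · exact hbot j (by simp [h])
  · rcases hp.cases with ⟨b, hb, hu⟩ | ⟨b, b', hb, hb', hu⟩ | ⟨b, hb, hu⟩
    · have := hu j (by simp [Cat.sp, h]); subst this; simp [h] at hb
    · have h1 := hp.top b j hb h
      have h2 := hbot b (by simp [hb])
      exact hp.far i hi j (hp.act j (by simp [h]) (by simp [h])) (by omega)
    · have := hu j (by simp [Cat.sp, h]); subst this; simp [h] at hb
  · exact hbot j (by simp [h])

theorem y_dec {r : ℕ} {a : ℕ → ℝ} {M K : ℝ} {L : ℕ} (hM : 1 ≤ M) (hA : Ana r a M K L)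
    {κ : Fin r → Cat} {pr : Fin r → Fin r}
    {E : Fin r → Fin r → Prop} {p q : Vec r} (hbp : Base a M K p) (hbq : Base a M K q)
    (hp : PT L κ pr E p) (hq : PT L κ pr E q)
    (hy : ∀ i, cy κ p i = cy κ q i)
    (hzz : ∀ i, (∀ b, κ b = .botC → p.2 i ≠ p.2 b) → p.2 i = q.2 i) :
    ∀ i, ¬ (κ i).sp → p.1 i = q.1 i := by
  classical
  have hfol : ∀ i, κ i = .fol → p.1 i = q.1 i := fun i hi => by simpa [cy, hi] using hy i
  have hnear : ∀ i, κ i = .near → p.1 i = q.1 i := fun i hi => by simpa [cy, hi] using hy i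
  have hzero : ∀ i, κ i = .zero → p.1 i = q.1 i := by
    intro i hi
    have h1 := hp.zero i hi
    have h2 := hq.zero i hi
    unfold gs at h1 h2
    have hset : univ.filter (fun j => q.2 j = q.2 i) = univ.filter (fun j => p.2 j = p.2 i) := by
      ext j; simp only [mem_filter, mem_univ, true_and, ← hp.eqv, ← hq.eqv]
    rw [hset] at h2
    have hmem : i ∈ univ.filter (fun j => p.2 j = p.2 i) := by simp
    rw [← Finset.add_sum_erase _ _ hmem] at h1 h2
    have : ∑ j ∈ (univ.filter (fun j => p.2 j = p.2 i)).erase i, p.1 j =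
        ∑ j ∈ (univ.filter (fun j => p.2 j = p.2 i)).erase i, q.1 j := by
      refine Finset.sum_congr rfl fun j hj => hfol j ?_
      simp only [mem_erase, mem_filter, mem_univ, true_and] at hj
      by_contra hcon
      exact hj.1 (hp.uniq j i hcon (by simp [hi]) hj.2)
    omega
  have hfar : ∀ i, κ i = .far → p.1 i = q.1 i := by
    by_contra hcon
    push Not at hcon
    obtain ⟨i0, hi0⟩ := hcon
    obtain ⟨i, hi, hmax⟩ := Finset.exists_max_image
      (univ.filter (fun i => κ i = .far ∧ p.1 i ≠ q.1 i)) p.2 ⟨i0, by simpa using hi0⟩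
    simp only [mem_filter, mem_univ, true_and] at hi hmax
    have nb : ∀ k, κ k ≠ .fol → κ k ≠ .botC → p.2 k = q.2 k := by
      intro k h1 h2
      refine hzz k fun b hb he => h2 ?_
      rw [hp.uniq k b h1 (by simp [hb]) he, hb]
    have ei := nb i (by simp [hi.1]) (by simp [hi.1])
    refine hi.2 (far_unique hM hA hbp hbq i ei (hp.farL i hi.1) ?_)
    intro j hji
    by_cases hsp : (κ j).sp
    · right
      refine ⟨sp_far hp hi.1 hsp, ?_⟩
      rw [ei]; exact sp_far hq hi.1 hsp
    rcases hk : κ j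
    · by_cases hb : ∃ b, κ b = .botC ∧ p.2 j = p.2 b
      · obtain ⟨b, hb, hjb⟩ := hb
        have hjb' : q.2 j = q.2 b := (hq.eqv _ _).1 ((hp.eqv _ _).2 hjb)
        right
        rw [hjb, hjb']
        refine ⟨sp_far hp hi.1 (by simp [Cat.sp, hb]), ?_⟩
        rw [ei]; exact sp_far hq hi.1 (by simp [Cat.sp, hb])
      · push Not at hb
        exact Or.inl ⟨hfol j hk, hzz j hb⟩
    · exact Or.inl ⟨hzero j hk, nb j (by simp [hk]) (by simp [hk])⟩
    · exact Or.inl ⟨hnear j hk, nb j (by simp [hk]) (by simp [hk])⟩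
    · have ej := nb j (by simp [hk]) (by simp [hk])
      by_cases he : p.1 j = q.1 j
      · exact Or.inl ⟨he, ej⟩
      · right
        have h1 := hmax j ⟨hk, he⟩
        have h2 : p.2 j ≠ p.2 i := fun h => hji (hp.uniq j i (by simp [hk]) (by simp [hi.1]) h)
        have h3 := hp.far i hi.1 j (hp.act j (by simp [hk]) (by simp [hk])) (by omega)
        exact ⟨h3, by rw [← ej]; exact h3⟩
    all_goals exact absurd (by simp [Cat.sp, hk]) hsp
  intro i hi
  rcases hk : κ i
  · exact hfol i hk
  · exact hzero i hk
  · exact hnear i hk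
  · exact hfar i hk
  all_goals exact absurd (by simp [Cat.sp, hk]) hi

theorem dec {r : ℕ} {a : ℕ → ℝ} {M K : ℝ} {L : ℕ} (hM : 1 ≤ M) (hA : Ana r a M K L)
    {κ : Fin r → Cat} {pr : Fin r → Fin r}
    {E : Fin r → Fin r → Prop} {p q : Vec r} (hbp : Base a M K p) (hbq : Base a M K q)
    (hp : PT L κ pr E p) (hq : PT L κ pr E q)
    (hy : ∀ i, cy κ p i = cy κ q i)
    (hz : ∀ i, cz κ p i = cz κ q i) (hd : ∀ i, cd κ pr p i = cd κ pr q i) : p = q := by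
  classical
  have hzz := fun i => z_dec hp hq hz hd _ i rfl
  have hyy := y_dec hM hA hbp hbq hp hq hy hzz
  have one : ∀ b, (∀ i, (κ i).sp → i = b) → p.1 = q.1 := by
    intro b hu
    have h1 : ∀ j, j ≠ b → p.1 j = q.1 j := fun j hj => hyy j fun h => hj (hu j h)
    have h2 := hbp.h0.trans hbq.h0.symm
    rw [← Finset.add_sum_erase _ _ (mem_univ b), ← Finset.add_sum_erase _ q.1 (mem_univ b),
      Finset.sum_congr rfl fun j hj => h1 j (Finset.ne_of_mem_erase hj)] at h2
    funext j
    by_cases hj : j = b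
    · subst hj; linarith
    · exact h1 j hj
  have hs1 := abs_le.1 hbp.hs
  have hs2 := abs_le.1 hbq.hs
  rcases hp.cases with ⟨b, hb, hu⟩ | ⟨b, b', hb, hb', hu⟩ | ⟨b, hb, hu⟩
  · refine Prod.ext (one b hu) (funext fun i => hzz i fun b' hb' => ?_)
    have := hu b' (by simp [Cat.sp, hb']); subst this; simp [hb'] at hb
  · have ez : p.2 = q.2 := by
      refine funext fun i => hzz i fun c hc => ?_
      rcases hu c (by simp [Cat.sp, hc]) with h | h <;> subst h
      · simp [hc] at hb
      · simp [hc] at hb'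
    have hne : b' ≠ b := by rintro rfl; simp [hb] at hb'
    have hmem : b' ∈ univ.erase b := by simp [hne]
    have h1 : ∀ j ∈ (univ.erase b).erase b', p.1 j = q.1 j := by
      intro j hj
      simp only [mem_erase, mem_univ, and_true] at hj
      exact hyy j fun h => by rcases hu j h with h | h <;> simp_all
    have h2 := hbp.h0.trans hbq.h0.symm
    rw [← Finset.add_sum_erase _ _ (mem_univ b), ← Finset.add_sum_erase _ q.1 (mem_univ b),
      ← Finset.add_sum_erase _ _ hmem, ← Finset.add_sum_erase _ q.1 hmem,
      Finset.sum_congr rfl h1] at h2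
    have h3 : ∑ j ∈ (univ.erase b).erase b', (p.1 j : ℝ) * a (p.2 j) =
        ∑ j ∈ (univ.erase b).erase b', (q.1 j : ℝ) * a (p.2 j) :=
      Finset.sum_congr rfl fun j hj => by rw [h1 j hj]
    rw [← Finset.add_sum_erase _ _ (mem_univ b), ← Finset.add_sum_erase _ _ hmem, h3] at hs1
    rw [← Finset.add_sum_erase _ _ (mem_univ b), ← Finset.add_sum_erase _ _ hmem, ← ez] at hs2
    have hgap := hA.gap _ _ (hp.nlow b (by simp [hb])) (hp.top b b' hb hb').1
    have hD : p.1 b - q.1 b = -(p.1 b' - q.1 b') := by linarith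
    have hDr : (p.1 b : ℝ) - q.1 b = -((p.1 b' : ℝ) - q.1 b') := by exact_mod_cast hD
    have hKn : 0 ≤ K := (abs_nonneg _).trans hbp.hs
    have hlt : |(p.1 b' : ℝ) - q.1 b'| < 1 := by
      by_contra hcon
      push Not at hcon
      have hb1 : |((p.1 b' : ℝ) - q.1 b') * (a (p.2 b') - a (p.2 b))| ≤ 2 * K := by
        have : ((p.1 b' : ℝ) - q.1 b') * (a (p.2 b') - a (p.2 b)) =
          ((p.1 b' : ℝ) - q.1 b') * a (p.2 b') + ((p.1 b : ℝ) - q.1 b) * a (p.2 b) := by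
          rw [hDr]; ring
        rw [this, abs_le]
        constructor <;> linarith [hs1.1, hs1.2, hs2.1, hs2.2]
      rw [abs_mul, abs_of_pos (by linarith : 0 < a (p.2 b') - a (p.2 b))] at hb1
      nlinarith
    have h4 : |p.1 b' - q.1 b'| < 1 := by exact_mod_cast hlt
    have h5 := Int.abs_lt_one_iff.1 h4
    refine Prod.ext (funext fun j => ?_) ez
    by_cases hj : j = b
    · subst hj; omega
    by_cases hj' : j = b'
    · subst hj'; omega
    exact h1 j (by simp [hj, hj'])
  · have ey := one b hu
    have hother : ∀ i, p.2 i ≠ p.2 b → p.2 i = q.2 i := by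
      intro i hi
      refine hzz i fun c hc => ?_
      rw [hu c (by simp [Cat.sp, hc])]; exact hi
    have hE : ∀ i, p.2 i = p.2 b → q.2 i = q.2 b := fun i hi =>
      (hq.eqv _ _).1 ((hp.eqv _ _).2 hi)
    have hbb : p.2 b = q.2 b := by
      have hg := hp.act b (by simp [hb]) (by simp [hb])
      have hdiff : (∑ i, (p.1 i : ℝ) * a (p.2 i)) - ∑ i, (q.1 i : ℝ) * a (q.2 i) =
          (gs p b : ℝ) * (a (p.2 b) - a (q.2 b)) := by
        unfold gs
        rw [← Finset.sum_sub_distrib, Int.cast_sum, Finset.sum_mul, Finset.sum_filter]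
        refine Finset.sum_congr rfl fun i _ => ?_
        split_ifs with hi
        · rw [hi, hE i hi, ey]; ring
        · rw [hother i hi, ey]; ring
      have hg1 : (1 : ℝ) ≤ |(gs p b : ℝ)| := by exact_mod_cast Int.one_le_abs hg
      have hle : |(gs p b : ℝ) * (a (p.2 b) - a (q.2 b))| ≤ 2 * K := by
        rw [← hdiff, abs_le]; constructor <;> linarith [hs1.1, hs1.2, hs2.1, hs2.2]
      rw [abs_mul] at hle
      have hle2 : |a (p.2 b) - a (q.2 b)| ≤ 2 * K := by
        nlinarith [abs_nonneg (a (p.2 b) - a (q.2 b))]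
      have := abs_le.1 hle2
      rcases lt_trichotomy (p.2 b) (q.2 b) with h | h | h
      · have := hA.gap _ _ (hp.nlow b (by simp [hb])) h
        linarith
      · exact h
      · have := hA.gap _ _ (hq.nlow b (by simp [hb])) h
        linarith
    refine Prod.ext ey (funext fun i => ?_)
    by_cases hi : p.2 i = p.2 b
    · rw [hi, hE i hi, hbb]
    · exact hother i hi

theorem count_type {r : ℕ} {a : ℕ → ℝ} {M K : ℝ} {L : ℕ} (hM : 1 ≤ M) (hA : Ana r a M K L)
    (κ : Fin r → Cat) (pr : Fin r → Fin r) (E : Fin r → Fin r → Prop) :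
    ({p : Vec r | Base a M K p ∧ PT L κ pr E p}.ncard : ℝ) ≤
      (3 * M) ^ (r - 1) * ((L : ℝ) + 1) ^ r := by
  classical
  rcases Set.eq_empty_or_nonempty {p : Vec r | Base a M K p ∧ PT L κ pr E p} with he | ⟨p0, hp0⟩
  · rw [he, Set.ncard_empty]; push_cast; positivity
  obtain ⟨i0, hi0⟩ : ∃ i0, κ i0 = .lowbot ∨ κ i0 = .topB ∨ κ i0 = .botC := by
    rcases hp0.2.cases with ⟨b, hb, hu⟩ | ⟨b, b', hb, hb', hu⟩ | ⟨b, hb, hu⟩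
    · exact ⟨b, by simp [hb]⟩
    · exact ⟨b', by simp [hb']⟩
    · exact ⟨b, by simp [hb]⟩
  set m : ℕ := ⌊M⌋₊ with hm
  have hmM : (m : ℝ) ≤ M := Nat.floor_le (by linarith)
  let By : Fin r → Finset ℤ := fun i =>
    if κ i = .fol ∨ κ i = .near then Finset.Icc (-(m : ℤ)) m else {0}
  let Bz : Fin r → Finset ℕ := fun i =>
    if κ i = .zero ∨ κ i = .far ∨ κ i = .botB then Finset.range (m + 1) else {0}
  let B := (Fintype.piFinset By) ×ˢ (Fintype.piFinset Bz) ×ˢ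
    (Fintype.piFinset (fun _ : Fin r => Finset.range (L + 1)))
  have hcard : {p : Vec r | Base a M K p ∧ PT L κ pr E p}.ncard ≤ (B : Set ((Fin r → ℤ) × (Fin r → ℕ) × (Fin r → ℕ))).ncard := by
    refine Set.ncard_le_ncard_of_injOn (fun p => (cy κ p, cz κ p, cd κ pr p)) ?_ ?_ B.finite_toSet
    · rintro p ⟨hb, hp⟩
      simp only [B, Finset.mem_coe, Finset.mem_product, Fintype.mem_piFinset]
      refine ⟨fun i => ?_, fun i => ?_, fun i => ?_⟩
      · simp only [By, cy]
        split_ifs with h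
        · have h1 : ((|p.1 i|.toNat : ℕ) : ℝ) ≤ M := by
            have h2 := hb.hy i
            have h3 : ((|p.1 i|.toNat : ℕ) : ℤ) = |p.1 i| := Int.toNat_of_nonneg (abs_nonneg _)
            have h4 : ((|p.1 i|.toNat : ℕ) : ℝ) = ((|p.1 i| : ℤ) : ℝ) := by exact_mod_cast h3
            rw [h4, Int.cast_abs]; exact h2
          have h2 := Nat.le_floor h1
          have h3 : |p.1 i| ≤ (m : ℤ) := by omega
          rw [Finset.mem_Icc]; exact abs_le.1 h3
        · simp
      · simp only [Bz, cz]
        split_ifs with h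
        · have := Nat.le_floor (hb.hz i).2
          rw [Finset.mem_range]; omega
        · simp
      · rw [Finset.mem_range]
        simp only [cd]
        split_ifs with h h'
        · have := hp.near i h; omega
        · have := hp.low i h'; omega
        · omega
    · rintro p ⟨hb, hp⟩ q ⟨hb', hq⟩ he
      simp only [Prod.mk.injEq] at he
      exact dec hM hA hb hb' hp hq (fun i => congrFun he.1 i) (fun i => congrFun he.2.1 i)
        (fun i => congrFun he.2.2 i)
  have hB : ((B : Set ((Fin r → ℤ) × (Fin r → ℕ) × (Fin r → ℕ))).ncard : ℝ) = (∏ i, ((By i).card * (Bz i).card : ℝ)) * ((L : ℝ) + 1) ^ r := by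
    rw [Set.ncard_coe_finset]
    simp only [B, Finset.card_product, Fintype.card_piFinset, Finset.card_range, Finset.prod_const,
      Finset.card_univ, Fintype.card_fin]
    push_cast
    rw [Finset.prod_mul_distrib]; ring
  have hterm : ∀ i, ((By i).card * (Bz i).card : ℝ) ≤ 3 * M := by
    intro i
    have e1 : (((Finset.Icc (-(m : ℤ)) m).card : ℕ) : ℝ) = 2 * m + 1 := by
      rw [Int.card_Icc]
      have : ((m : ℤ) + 1 - -(m : ℤ)).toNat = 2 * m + 1 := by omega
      rw [this]; push_cast; ring
    rcases hk : κ i <;> simp [By, Bz, hk, -Int.card_Icc, e1] <;> linarith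
  have hterm0 : ((By i0).card * (Bz i0).card : ℝ) = 1 := by
    rcases hi0 with h | h | h <;> simp [By, Bz, h]
  refine (Nat.cast_le.2 hcard).trans ?_
  rw [hB]
  refine mul_le_mul_of_nonneg_right ?_ (by positivity)
  rw [← Finset.mul_prod_erase _ _ (mem_univ i0), hterm0, one_mul]
  refine (Finset.prod_le_prod (fun i _ => by positivity) (fun i _ => hterm i)).trans ?_
  rw [Finset.prod_const, Finset.card_erase_of_mem (mem_univ _), Finset.card_univ, Fintype.card_fin]

theorem lac_pow {c : ℝ} (hc : 1 < c) {a : ℕ → ℝ} (hlac : ∀ n ≥ 1, c * a n ≤ a (n + 1))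
    (m : ℕ) (hm : 1 ≤ m) (k : ℕ) : c ^ k * a m ≤ a (m + k) := by
  induction k with
  | zero => simp
  | succ k ih =>
    calc c ^ (k + 1) * a m = c * (c ^ k * a m) := by ring
      _ ≤ c * a (m + k) := by gcongr
      _ ≤ a (m + k + 1) := hlac _ (by omega)

theorem mk_ana {c : ℝ} (hc : 1 < c) {a : ℕ → ℝ} (hpos : ∀ n ≥ 1, 0 < a n)
    (hlac : ∀ n ≥ 1, c * a n ≤ a (n + 1)) {r : ℕ} {M K : ℝ} {L : ℕ}
    (h1 : 4 * r * M ≤ c ^ L) (h2 : 4 * K < c ^ L * a 1) (h3 : 2 * K < (c - 1) * (c ^ L * a 1)) :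
    Ana r a M K L := by
  have mono : ∀ m n, 1 ≤ m → m ≤ n → a m ≤ a n := by
    intro m n hm hmn
    obtain ⟨k, rfl⟩ := Nat.exists_eq_add_of_le hmn
    refine le_trans ?_ (lac_pow hc hlac m hm k)
    exact le_mul_of_one_le_left (hpos m hm).le (one_le_pow₀ hc.le)
  have hbig : ∀ n, L < n → c ^ L * a 1 ≤ a n := by
    intro n hn
    exact (lac_pow hc hlac 1 le_rfl L).trans (mono _ _ (by omega) (by omega))
  refine ⟨hpos, ?_, ?_, ?_⟩
  · intro m n hm hmn
    calc 4 * r * M * a m ≤ c ^ L * a m := mul_le_mul_of_nonneg_right h1 (hpos m hm).le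
      _ ≤ a (m + L) := lac_pow hc hlac m hm L
      _ ≤ a n := mono _ _ (by omega) (by omega)
  · intro n hn
    exact h2.trans_le (hbig n hn)
  · intro m n hm hmn
    have e1 := hlac m (by omega)
    have e2 := mono (m + 1) n (by omega) (by omega)
    have e3 := hbig m hm
    have e4 : (c - 1) * (c ^ L * a 1) ≤ (c - 1) * a m :=
      mul_le_mul_of_nonneg_left e3 (by linarith)
    linarith

theorem stmt6 (c : ℝ) (hc : 1 < c) (a : ℕ → ℝ) (ha1 : 0 < a 1)
    (hpos : ∀ n ≥ 1, 0 < a n) (hlac : ∀ n ≥ 1, c * a n ≤ a (n + 1))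
    (r : ℕ) (hr : 1 ≤ r) (ε : ℝ) (hε : 0 < ε) :
    ∃ K0 : ℝ, 0 < K0 ∧ ∀ M K : ℝ, 1 ≤ M → 1 ≤ K →
      ({p : (Fin r → ℤ) × (Fin r → ℕ) |
          (∀ i, |(p.1 i : ℝ)| ≤ M) ∧
          (∀ i, 1 ≤ p.2 i ∧ (p.2 i : ℝ) ≤ M) ∧
          ¬ (∀ i : Fin r, ∑ j ∈ Finset.univ.filter (fun j => p.2 j = p.2 i), p.1 j = 0) ∧
          |∑ i, (p.1 i : ℝ) * a (p.2 i)| ≤ K ∧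
          ∑ i, p.1 i = 0}.ncard : ℝ) ≤
        K0 * K ^ r * M ^ ((r : ℝ) - 1 + ε) := by
  classical
  let T := (Fin r → Cat) × (Fin r → Fin r) × (Fin r → Fin r → Prop)
  have hr' : (1 : ℝ) ≤ r := by exact_mod_cast hr
  have hc1 : 0 < c - 1 := by linarith
  have hlogc : 0 < Real.log c := Real.log_pos hc
  let C0 : ℝ := 4 * r + 5 / a 1 + 3 / ((c - 1) * a 1)
  let η : ℝ := min ε 1
  have hη : 0 < η := lt_min hε one_pos
  let δ : ℝ := η / r
  have hδ : 0 < δ := by positivity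
  let C1 : ℝ := 1 / (δ * Real.log c) + 2
  have hC0 : 0 < C0 := by positivity
  have hC01 : 1 ≤ C0 := by
    have h1 : 0 < 5 / a 1 := by positivity
    have h2 : 0 < 3 / ((c - 1) * a 1) := by positivity
    simp only [C0]; linarith
  have hC1 : 0 < C1 := by positivity
  refine ⟨(Fintype.card T : ℝ) * 3 ^ (r - 1) * C1 ^ r * C0 ^ η + 1, by positivity, ?_⟩
  intro M K hM hK
  have hMK : 1 ≤ K * M := by nlinarith
  set Q : ℝ := C0 * (K * M) with hQ
  have hQ1 : 1 ≤ Q := by nlinarith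
  set L : ℕ := ⌈Real.log Q / Real.log c⌉₊ with hL
  have hcL : Q ≤ c ^ L := by
    have h1 : Real.log Q / Real.log c ≤ L := Nat.le_ceil _
    rw [div_le_iff₀ hlogc, ← Real.log_pow] at h1
    exact (Real.log_le_log_iff (by linarith) (by positivity)).1 h1
  have hana : Ana r a M K L := by
    have q1 : 4 * r * M ≤ Q := by
      have : 4 * (r : ℝ) ≤ C0 := by
        have h1 : 0 < 5 / a 1 := by positivity
        have h2 : 0 < 3 / ((c - 1) * a 1) := by positivity
        simp only [C0]; linarith
      calc 4 * r * M ≤ C0 * M := by gcongr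
        _ ≤ C0 * (K * M) := by gcongr; nlinarith
    have q2 : 5 / a 1 * K ≤ Q := by
      have : 5 / a 1 ≤ C0 := by
        have h2 : 0 < 3 / ((c - 1) * a 1) := by positivity
        simp only [C0]; linarith
      calc 5 / a 1 * K ≤ C0 * K := by gcongr
        _ ≤ C0 * (K * M) := by gcongr; nlinarith
    have q3 : 3 / ((c - 1) * a 1) * K ≤ Q := by
      have : 3 / ((c - 1) * a 1) ≤ C0 := by
        have h2 : 0 < 5 / a 1 := by positivity
        simp only [C0]; linarith
      calc 3 / ((c - 1) * a 1) * K ≤ C0 * K := by gcongr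
        _ ≤ C0 * (K * M) := by gcongr; nlinarith
    refine mk_ana hc hpos hlac (q1.trans hcL) ?_ ?_
    · calc 4 * K < 5 * K := by linarith
        _ = 5 / a 1 * K * a 1 := by field_simp
        _ ≤ c ^ L * a 1 := by gcongr; exact q2.trans hcL
    · calc 2 * K < 3 * K := by linarith
        _ = (c - 1) * (3 / ((c - 1) * a 1) * K * a 1) := by field_simp
        _ ≤ (c - 1) * (c ^ L * a 1) := by gcongr; exact q3.trans hcL
  have hcount : ({p : (Fin r → ℤ) × (Fin r → ℕ) |
          (∀ i, |(p.1 i : ℝ)| ≤ M) ∧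
          (∀ i, 1 ≤ p.2 i ∧ (p.2 i : ℝ) ≤ M) ∧
          ¬ (∀ i : Fin r, ∑ j ∈ Finset.univ.filter (fun j => p.2 j = p.2 i), p.1 j = 0) ∧
          |∑ i, (p.1 i : ℝ) * a (p.2 i)| ≤ K ∧
          ∑ i, p.1 i = 0}.ncard : ℝ) ≤
        (Fintype.card T : ℝ) * ((3 * M) ^ (r - 1) * ((L : ℝ) + 1) ^ r) := by
    let S : T → Set (Vec r) := fun t => {p : Vec r | Base a M K p ∧ PT L t.1 t.2.1 t.2.2 p}
    have hfin : (⋃ t, S t).Finite := by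
      set m : ℕ := ⌊M⌋₊ with hm
      refine Set.Finite.subset (s := (Set.pi Set.univ fun _ : Fin r => Set.Icc (-(m : ℤ)) m) ×ˢ
        (Set.pi Set.univ fun _ : Fin r => Set.Iic m)) ?_ ?_
      · exact (Set.Finite.pi fun _ => Set.finite_Icc _ _).prod
          (Set.Finite.pi fun _ => Set.finite_Iic _)
      · intro p hp
        obtain ⟨t, hb, -⟩ := Set.mem_iUnion.1 hp
        refine ⟨fun i _ => ?_, fun i _ => Nat.le_floor (hb.hz i).2⟩
        have h2 := abs_le.1 (hb.hy i)
        have h3 : p.1 i ≤ ⌊M⌋ := Int.le_floor.2 h2.2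
        have h4 : -p.1 i ≤ ⌊M⌋ := Int.le_floor.2 (by push_cast; linarith)
        have h5 : ((⌊M⌋₊ : ℕ) : ℤ) = ⌊M⌋ := Int.natCast_floor_eq_floor (by linarith)
        constructor <;> omega
    refine (Nat.cast_le.2 ((Set.ncard_le_ncard (t := ⋃ t, S t) ?_ hfin).trans
      (Set.ncard_iUnion_le_of_fintype S))).trans ?_
    · rintro p ⟨h1, h2, h3, h4, h5⟩
      obtain ⟨κ, pr, E, h⟩ := exists_PT L p h3
      exact Set.mem_iUnion.2 ⟨(κ, pr, E), ⟨h1, h2, h4, h5⟩, h⟩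
    · push_cast
      refine (Finset.sum_le_sum fun t _ => count_type hM hana t.1 t.2.1 t.2.2).trans ?_
      rw [Finset.sum_const, nsmul_eq_mul, Finset.card_univ]
  refine hcount.trans ?_
  have hL1 : (L : ℝ) + 1 ≤ C1 * Q ^ δ := by
    have h1 : (L : ℝ) < Real.log Q / Real.log c + 1 :=
      Nat.ceil_lt_add_one (div_nonneg (Real.log_nonneg hQ1) hlogc.le)
    have h2 : Real.log Q ≤ Q ^ δ / δ := Real.log_le_rpow_div (by linarith) hδ
    have h3 : 1 ≤ Q ^ δ := Real.one_le_rpow hQ1 hδ.le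
    have h4 : Real.log Q / Real.log c ≤ Q ^ δ / δ / Real.log c := by gcongr
    have h5 : C1 * Q ^ δ = Q ^ δ / δ / Real.log c + 2 * Q ^ δ := by
      simp only [C1]; field_simp
    linarith
  have hLr : ((L : ℝ) + 1) ^ r ≤ C1 ^ r * (C0 ^ η * (K ^ r * M ^ ε)) := by
    calc ((L : ℝ) + 1) ^ r ≤ (C1 * Q ^ δ) ^ r := by gcongr
      _ = C1 ^ r * Q ^ η := by
        rw [mul_pow, ← Real.rpow_mul_natCast (by linarith)]
        congr 2
        simp only [δ]; field_simp
      _ = C1 ^ r * (C0 ^ η * (K ^ η * M ^ η)) := by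
        rw [hQ, Real.mul_rpow hC0.le (by linarith), Real.mul_rpow (by linarith) (by linarith)]
      _ ≤ C1 ^ r * (C0 ^ η * (K ^ r * M ^ ε)) := by
        have e1 : K ^ η ≤ K ^ r := by
          rw [← Real.rpow_natCast]
          exact Real.rpow_le_rpow_of_exponent_le hK ((min_le_right _ _).trans hr')
        have e2 : M ^ η ≤ M ^ ε := Real.rpow_le_rpow_of_exponent_le hM (min_le_left _ _)
        gcongr
  have hMp : M ^ ((r : ℝ) - 1 + ε) = M ^ (r - 1) * M ^ ε := by
    rw [Real.rpow_add (by linarith), ← Real.rpow_natCast, Nat.cast_sub hr, Nat.cast_one]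
  rw [hMp]
  calc (Fintype.card T : ℝ) * ((3 * M) ^ (r - 1) * ((L : ℝ) + 1) ^ r)
      ≤ (Fintype.card T : ℝ) * ((3 * M) ^ (r - 1) * (C1 ^ r * (C0 ^ η * (K ^ r * M ^ ε)))) := by
        gcongr
    _ = ((Fintype.card T : ℝ) * 3 ^ (r - 1) * C1 ^ r * C0 ^ η) * K ^ r * (M ^ (r - 1) * M ^ ε) := by
        rw [mul_pow]; ring
    _ ≤ _ := by
        gcongr
        linarith
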